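/- Let φ ∈ Φ, let {K_w}_{w>0} satisfy condition (K_w.1) with absolute constant A > 0, and let f : ℝ^N_+ → ℝ be measurable and in the domain of the operators T_w. Then for every interval I ⊂ ℝ^N_+, every λ > 0 and every w > 0, V^φ_I[λ(T_w f)] ≤ A^{−1} ∫_{ℝ^N_+} V^φ_I[λ A (τ_t f)] |K_w(t)| ⟨t⟩^{−1} dt, where (τ_t f)(s) := f(st). -/

import Mathlib

open MeasureTheory Filter Set Asymptotics
open scoped ENNReal

noncomputable section

/-- The class `Φ`: `φ : [0,∞) → [0,∞)` convex, vanishing exactly at `0`,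
with `φ(u)/u → 0` as `u → 0⁺`. -/
def IsPhiFun (φ : ℝ → ℝ) : Prop :=
  ConvexOn ℝ (Set.Ici 0) φ ∧ (∀ u, 0 ≤ u → 0 ≤ φ u) ∧
  (∀ u, 0 ≤ u → (φ u = 0 ↔ u = 0)) ∧
  Tendsto (fun u => φ u / u) (nhdsWithin 0 (Set.Ioi 0)) (nhds 0)

/-- The positive orthant `ℝ^N_+ = (0,∞)^N`. -/
def RPos (N : ℕ) : Set (Fin N → ℝ) := {x | ∀ i, 0 < x i}

/-- `⟨t⟩ := ∏ᵢ tᵢ`. -/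
def prodCoord {N : ℕ} (t : Fin N → ℝ) : ℝ := ∏ i, t i

/-- Euclidean distance `|1 - t|`. -/
def distOne {N : ℕ} (t : Fin N → ℝ) : ℝ := Real.sqrt (∑ i, (1 - t i) ^ 2)

/-- Euclidean norm `|log t|` of `log t := (log t₁, …, log t_N)`. -/
def logNorm {N : ℕ} (t : Fin N → ℝ) : ℝ := Real.sqrt (∑ i, Real.log (t i) ^ 2)

/-- `t^w := (t₁^w, …, t_N^w)`. -/
def powVec {N : ℕ} (t : Fin N → ℝ) (w : ℝ) : Fin N → ℝ := fun i => t i ^ w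

/-- The (Musielak–Orlicz) `φ`-variation of `g` on `[a,b]`:
`sup_D ∑ᵢ φ(|g(sᵢ) - g(sᵢ₋₁)|)` over all partitions `D` of `[a,b]`. -/
def phiVar1 (φ : ℝ → ℝ) (a b : ℝ) (g : ℝ → ℝ) : ℝ≥0∞ :=
  ⨆ (n : ℕ) (u : Fin (n + 1) → ℝ) (_ : Monotone u) (_ : u 0 = a) (_ : u (Fin.last n) = b),
    ∑ i : Fin n, ENNReal.ofReal (φ |g (u i.succ) - g (u i.castSucc)|)

/-- The point of `ℝ^N` obtained from `x'` (coordinates `≠ j`) by inserting `s`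
at the `j`-th coordinate. -/
def insertCoord {N : ℕ} (j : Fin N) (x' : {i : Fin N // i ≠ j} → ℝ) (s : ℝ) :
    Fin N → ℝ :=
  fun i => if h : i = j then s else x' ⟨i, h⟩

/-- `Φ^φ_j(f, I)`: the integral over `I'_j` (with weight `⟨x'_j⟩⁻¹`) of the `φ`-variations
of the `j`-th sections of `f`, where `I = ∏ᵢ [aᵢ, bᵢ]`. -/
def secVar {N : ℕ} (φ : ℝ → ℝ) (f : (Fin N → ℝ) → ℝ) (a b : Fin N → ℝ) (j : Fin N) :
    ℝ≥0∞ :=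
  ∫⁻ x' in Set.pi Set.univ (fun i : {i : Fin N // i ≠ j} => Set.Icc (a i.1) (b i.1)),
    phiVar1 φ (a j) (b j) (fun s => f (insertCoord j x' s)) *
      ENNReal.ofReal ((∏ i : {i : Fin N // i ≠ j}, x' i)⁻¹)

/-- `Φ^φ(f, I) := (∑_j Φ^φ_j(f,I)²)^{1/2}`. -/
def boxPhi {N : ℕ} (φ : ℝ → ℝ) (f : (Fin N → ℝ) → ℝ) (a b : Fin N → ℝ) : ℝ≥0∞ :=
  (∑ j : Fin N, secVar φ f a b j ^ 2) ^ ((1 : ℝ) / 2)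

/-- `{J_1, …, J_m}`, with `J_k = ∏ᵢ [c k i, d k i]`, is a partition of `I = ∏ᵢ [aᵢ, bᵢ]`
into non-overlapping `N`-dimensional intervals covering `I`. -/
def IsBoxPartition {N : ℕ} (a b : Fin N → ℝ) {m : ℕ} (c d : Fin m → Fin N → ℝ) : Prop :=
  (∀ k i, c k i ≤ d k i) ∧
  (⋃ k, Set.pi Set.univ fun i => Set.Icc (c k i) (d k i)) =
    Set.pi Set.univ (fun i => Set.Icc (a i) (b i)) ∧
  Pairwise fun k l =>
    Disjoint (Set.pi Set.univ fun i => Set.Ioo (c k i) (d k i))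
      (Set.pi Set.univ fun i => Set.Ioo (c l i) (d l i))

/-- The multidimensional (Tonelli-type) `φ`-variation `V^φ_I[f]` of `f` on
`I = ∏ᵢ [aᵢ, bᵢ]`: the sup of `∑ₖ Φ^φ(f, J_k)` over all partitions of `I` into
`N`-dimensional intervals. -/
def varOn {N : ℕ} (φ : ℝ → ℝ) (f : (Fin N → ℝ) → ℝ) (a b : Fin N → ℝ) : ℝ≥0∞ :=
  ⨆ (m : ℕ) (c : Fin m → Fin N → ℝ) (d : Fin m → Fin N → ℝ) (_ : IsBoxPartition a b c d),
    ∑ k, boxPhi φ f (c k) (d k)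

/-- `V^φ[f]`, the `φ`-variation of `f` over the whole `ℝ^N_+`: the sup of `V^φ_I[f]`
over all intervals `I ⊂ ℝ^N_+`. -/
def totalVar {N : ℕ} (φ : ℝ → ℝ) (f : (Fin N → ℝ) → ℝ) : ℝ≥0∞ :=
  ⨆ (a : Fin N → ℝ) (b : Fin N → ℝ) (_ : ∀ i, 0 < a i) (_ : ∀ i, a i ≤ b i),
    varOn φ f a b

/-- `f ∈ BV^φ(ℝ^N_+)`: `f` measurable with `V^φ[λ f] < ∞` for some `λ > 0`. -/
def MemBVphi {N : ℕ} (φ : ℝ → ℝ) (f : (Fin N → ℝ) → ℝ) : Prop :=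
  Measurable f ∧ ∃ l > (0 : ℝ), totalVar φ (fun x => l * f x) < ⊤

/-- The Mellin-type operator `(T f)(s) := ∫_{ℝ^N_+} K(t) f(st) ⟨t⟩⁻¹ dt`. -/
def mellinOp {N : ℕ} (K : (Fin N → ℝ) → ℝ) (f : (Fin N → ℝ) → ℝ) (s : Fin N → ℝ) : ℝ :=
  ∫ t in RPos N, K t * f (s * t) * (prodCoord t)⁻¹

/-- `f` belongs to the domain of the operators `T_w`: the defining integrals exist
finitely for every `s ∈ ℝ^N_+` and `w > 0`. -/
def InDomain {N : ℕ} (K : ℝ → (Fin N → ℝ) → ℝ) (f : (Fin N → ℝ) → ℝ) : Prop :=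
  ∀ w > (0 : ℝ), ∀ s ∈ RPos N,
    IntegrableOn (fun t => K w t * f (s * t) * (prodCoord t)⁻¹) (RPos N)

/-- Condition `(K_w.1)` with absolute constant `A`: each `K_w` is measurable and
integrable w.r.t. `⟨t⟩⁻¹ dt`, with `∫ |K_w| dμ ≤ A` and `∫ K_w dμ = 1`. -/
def KernelCond1 {N : ℕ} (K : ℝ → (Fin N → ℝ) → ℝ) (A : ℝ) : Prop :=
  ∀ w > (0 : ℝ), Measurable (K w) ∧
    IntegrableOn (fun t => K w t * (prodCoord t)⁻¹) (RPos N) ∧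
    (∫ t in RPos N, |K w t| * (prodCoord t)⁻¹) ≤ A ∧
    (∫ t in RPos N, K w t * (prodCoord t)⁻¹) = 1

/-- Condition `(K_w.2)`: for every `δ ∈ (0,1)`,
`∫_{|1-t|>δ} |K_w(t)| ⟨t⟩⁻¹ dt → 0` as `w → +∞`. -/
def KernelCond2 {N : ℕ} (K : ℝ → (Fin N → ℝ) → ℝ) : Prop :=
  ∀ δ : ℝ, 0 < δ → δ < 1 →
    Tendsto (fun w => ∫ t in {t ∈ RPos N | δ < distOne t}, |K w t| * (prodCoord t)⁻¹)
      atTop (nhds 0)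

/-- The `φ`-modulus of smoothness `ω^φ(f, δ) := sup_{|1-t| ≤ δ} V^φ[τ_t f - f]`. -/
def modSmooth {N : ℕ} (φ : ℝ → ℝ) (f : (Fin N → ℝ) → ℝ) (δ : ℝ) : ℝ≥0∞ :=
  ⨆ (t : Fin N → ℝ) (_ : t ∈ RPos N) (_ : distOne t ≤ δ),
    totalVar φ (fun s => f (s * t) - f s)

/-- `f` is locally `φ`-absolutely continuous on `ℝ^N_+` (uniformly, in the sense of
Tonelli) with constant `l`. -/
def LocACphiWith {N : ℕ} (φ : ℝ → ℝ) (f : (Fin N → ℝ) → ℝ) (l : ℝ) : Prop :=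
  ∀ a b : Fin N → ℝ, (∀ i, 0 < a i) → (∀ i, a i ≤ b i) → ∀ j : Fin N,
    ∀ ε > (0 : ℝ), ∃ δ > (0 : ℝ),
      ∀ᵐ x' ∂(volume.restrict
          (Set.pi Set.univ (fun i : {i : Fin N // i ≠ j} => Set.Icc (a i.1) (b i.1)))),
        ∀ n : ℕ, ∀ α β : Fin n → ℝ,
          (∀ i, a j ≤ α i ∧ α i ≤ β i ∧ β i ≤ b j) →
          (Pairwise fun i i' =>
            Disjoint (Set.Ioo (α i) (β i)) (Set.Ioo (α i') (β i'))) →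
          (∑ i, φ (β i - α i)) < δ →
          (∑ i, φ (l * |f (insertCoord j x' (β i)) - f (insertCoord j x' (α i))|)) < ε

/-- `f ∈ AC^φ(ℝ^N_+)`: `f` is measurable, of bounded `φ`-variation and locally
`φ`-absolutely continuous on `ℝ^N_+`. -/
def MemACphi {N : ℕ} (φ : ℝ → ℝ) (f : (Fin N → ℝ) → ℝ) : Prop :=
  MemBVphi φ f ∧ ∃ l > (0 : ℝ), LocACphiWith φ f l

/-- `{K_w}` is an `α`-singular kernel: for every `δ ∈ (0,1)`,
`∫_{|1-t|>δ} |K_w(t)| ⟨t⟩⁻¹ dt = O(w^{-α})` as `w → +∞`. -/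
def AlphaSingular {N : ℕ} (K : ℝ → (Fin N → ℝ) → ℝ) (α : ℝ) : Prop :=
  ∀ δ : ℝ, 0 < δ → δ < 1 →
    (fun w => ∫ t in {t ∈ RPos N | δ < distOne t}, |K w t| * (prodCoord t)⁻¹)
      =O[atTop] fun w : ℝ => w ^ (-α)

/-- The Lipschitz class `V^φ Lip_N(α)`: `f ∈ BV^φ(ℝ^N_+)` such that, for some `μ > 0`,
`V^φ[μ(τ_t f - f)] = O(|log t|^α)` as `|1 - t| → 0`. -/
def MemLipAlpha {N : ℕ} (φ : ℝ → ℝ) (α : ℝ) (f : (Fin N → ℝ) → ℝ) : Prop :=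
  MemBVphi φ f ∧ ∃ μ > (0 : ℝ), ∃ C > (0 : ℝ), ∃ η > (0 : ℝ),
    ∀ t ∈ RPos N, distOne t ≤ η →
      totalVar φ (fun x => μ * (f (x * t) - f x)) ≤ ENNReal.ofReal (C * logNorm t ^ α)

/-! ### Universal measurability of analytic sets -/

/-- A continuous image of the Baire space can be approximated in measure from inside by
compact sets. -/
theorem exists_isCompact_subset_range_le_measure {α : Type*} [TopologicalSpace α]
    [TopologicalSpace.PseudoMetrizableSpace α] [MeasurableSpace α] [BorelSpace α]
    (μ : Measure α) [IsFiniteMeasure μ] {f : (ℕ → ℕ) → α} (hf : Continuous f)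
    {r : ℝ≥0∞} (hr : r < μ (range f)) :
    ∃ C ⊆ range f, IsCompact C ∧ r ≤ μ C := by
  have step : ∀ (n : ℕ) (E : Set (ℕ → ℕ)), r < μ (f '' E) →
      ∃ m : ℕ, r < μ (f '' (E ∩ {x | x n ≤ m})) := by
    intro n E hE
    have hmono : Monotone fun m : ℕ => f '' (E ∩ {x | x n ≤ m}) := fun m m' h =>
      image_mono (inter_subset_inter_right _ fun x (hx : x n ≤ m) => hx.trans h)
    have hun : ⋃ m : ℕ, f '' (E ∩ {x | x n ≤ m}) = f '' E := by
      rw [← image_iUnion, ← inter_iUnion]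
      congr 1
      refine inter_eq_left.2 fun x _ => mem_iUnion.2 ⟨x n, le_refl (x n)⟩
    rw [← hun, hmono.measure_iUnion] at hE
    exact lt_iSup_iff.1 hE
  choose! m hm using step
  let E : ℕ → Set (ℕ → ℕ) := fun n => Nat.rec univ (fun n E => E ∩ {x | x n ≤ m n E}) n
  have hE : ∀ n, r < μ (f '' E n) := by
    intro n
    induction n with
    | zero => simpa [E] using hr
    | succ n ih => exact hm n _ ih
  set k : ℕ → ℕ := fun n => m n (E n) with hk
  have hEk : ∀ n, ∀ x ∈ E n, ∀ i < n, x i ≤ k i := by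
    intro n
    induction n with
    | zero => intro x _ i hi; omega
    | succ n ih =>
      intro x hx i hi
      rcases Nat.lt_succ_iff_lt_or_eq.1 hi with h | rfl
      · exact ih x hx.1 i h
      · exact hx.2
  have hK : IsCompact (univ.pi fun i => Iic (k i)) :=
    isCompact_univ_pi fun i => (finite_Iic (k i)).isCompact
  refine ⟨f '' univ.pi fun i => Iic (k i), image_subset_range _ _, hK.image hf, ?_⟩
  rw [Set.measure_eq_iInf_isOpen]
  refine le_iInf₂ fun U hKU => le_iInf fun hU => ?_
  obtain ⟨n, hn⟩ : ∃ n, f '' E n ⊆ U := by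
    by_contra! h
    simp only [not_subset, exists_mem_image] at h
    choose z hzE hzU using h
    obtain ⟨a, haK, σ, hσ, hlim⟩ := hK.tendsto_subseq (x := fun n i => min (z n i) (k i))
      fun n i _ => mem_Iic.2 (min_le_right _ _)
    have hlim' : Tendsto (fun n => z (σ n)) atTop (nhds a) := by
      rw [tendsto_pi_nhds] at hlim ⊢
      intro i
      refine (hlim i).congr' ?_
      filter_upwards [eventually_gt_atTop i] with n hn
      exact min_eq_left (hEk _ _ (hzE (σ n)) i (hn.trans_le (hσ.id_le n)))
    have := ((hf.tendsto a).comp hlim').eventually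
      (hU.mem_nhds (hKU (mem_image_of_mem f haK)))
    obtain ⟨n, hn⟩ := this.exists
    exact hzU _ hn
  exact (hE n).le.trans (measure_mono hn)

/-- Analytic sets are universally measurable. -/
theorem MeasureTheory.AnalyticSet.nullMeasurableSet {α : Type*} [TopologicalSpace α]
    [TopologicalSpace.MetrizableSpace α] [MeasurableSpace α] [BorelSpace α]
    {s : Set α} (hs : AnalyticSet s) (μ : Measure α) [SFinite μ] : NullMeasurableSet s μ := by
  suffices h : ∀ (ν : Measure α) [IsFiniteMeasure ν], NullMeasurableSet s ν from
    (h μ.toFinite).mono_ac (absolutelyContinuous_toFinite μ)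
  intro ν _
  rw [AnalyticSet] at hs
  rcases hs with rfl | ⟨f, hf, rfl⟩
  · exact nullMeasurableSet_empty
  rcases eq_or_ne (ν (range f)) 0 with h0 | h0
  · exact NullMeasurableSet.of_null h0
  obtain ⟨u, -, hu, hlim⟩ := exists_seq_strictMono_tendsto' (pos_iff_ne_zero.2 h0)
  choose C hCs hC hCu using fun n =>
    exists_isCompact_subset_range_le_measure ν hf (hu n).2
  have hmeas : MeasurableSet (⋃ n, C n) := .iUnion fun n => (hC n).measurableSet
  refine hmeas.nullMeasurableSet.congr (ae_eq_of_subset_of_measure_ge (iUnion_subset hCs) ?_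
    hmeas.nullMeasurableSet (measure_ne_top _ _))
  exact le_of_tendsto' hlim fun n => (hCu n).trans (measure_mono (subset_iUnion C n))

/-- The supremum of a jointly measurable function over a measurable set of parameters is
almost everywhere measurable. -/
theorem aemeasurable_biSup_of_measurable_uncurry {X Y : Type*} [TopologicalSpace X]
    [PolishSpace X] [MeasurableSpace X] [BorelSpace X] [TopologicalSpace Y] [PolishSpace Y]
    [MeasurableSpace Y] [BorelSpace Y] (μ : Measure X) [SFinite μ] {F : X × Y → ℝ≥0∞}
    (hF : Measurable F) {U : Set Y} (hU : MeasurableSet U) :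
    AEMeasurable (fun x => ⨆ y ∈ U, F (x, y)) μ := by
  refine NullMeasurable.aemeasurable ?_
  have hIoi : ∀ c : ℝ≥0∞, NullMeasurableSet ((fun x => ⨆ y ∈ U, F (x, y)) ⁻¹' Ioi c) μ := by
    intro c
    have : (fun x => ⨆ y ∈ U, F (x, y)) ⁻¹' Ioi c =
        Prod.fst '' {p : X × Y | p.2 ∈ U ∧ c < F p} := by
      ext x
      simp [lt_iSup_iff]
    rw [this]
    refine (MeasurableSet.analyticSet_image ?_ measurable_fst).nullMeasurableSet μ
    exact (measurable_snd hU).inter (hF measurableSet_Ioi)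
  exact measurable_of_Ioi (α := ℝ≥0∞) (δ := NullMeasurableSpace X μ) hIoi

/-! ### The class `Φ` -/

theorem IsPhiFun.map_zero {φ : ℝ → ℝ} (hφ : IsPhiFun φ) : φ 0 = 0 :=
  (hφ.2.2.1 0 le_rfl).2 rfl

theorem IsPhiFun.monotoneOn {φ : ℝ → ℝ} (hφ : IsPhiFun φ) : MonotoneOn φ (Ici 0) := by
  intro x hx y hy hxy
  rcases eq_or_lt_of_le (mem_Ici.1 hy) with h0 | h0
  · rw [le_antisymm hxy (h0 ▸ hx)]
  have hle : x / y ≤ 1 := (div_le_one h0).2 hxy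
  have h := hφ.1.2 (mem_Ici.2 le_rfl) hy (sub_nonneg.2 hle) (div_nonneg hx h0.le) (by ring)
  simp only [smul_eq_mul, mul_zero, zero_add, hφ.map_zero, div_mul_cancel₀ x h0.ne'] at h
  exact h.trans (mul_le_of_le_one_left (hφ.2.1 y hy) hle)

theorem IsPhiFun.measurable_comp_abs {φ : ℝ → ℝ} (hφ : IsPhiFun φ) :
    Measurable fun x => φ |x| := by
  have hmono : Monotone fun x => φ (max x 0) := fun x y h =>
    hφ.monotoneOn (mem_Ici.2 (le_max_right _ _)) (mem_Ici.2 (le_max_right _ _)) (max_le_max_right 0 h)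
  have := hmono.measurable.comp measurable_abs
  simpa [Function.comp_def] using this

/-- A supporting line of a `φ`-function at a positive point. -/
theorem IsPhiFun.exists_supporting_line {φ : ℝ → ℝ} (hφ : IsPhiFun φ) {y : ℝ} (hy : 0 < y) :
    ∃ p : ℝ, ∀ z, 0 ≤ z → φ y + p * (z - y) ≤ φ z := by
  have hyint : y ∈ interior (Ici (0 : ℝ)) := by simpa using hy
  refine ⟨derivWithin φ (Ioi y) y, fun z hz => ?_⟩
  rcases lt_trichotomy z y with h | rfl | h
  · have h1 := (hφ.1.slope_le_leftDeriv_of_mem_interior (mem_Ici.2 hz) hyint h).trans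
      (hφ.1.leftDeriv_le_rightDeriv_of_mem_interior hyint)
    rw [slope_def_field, div_le_iff₀ (sub_pos.2 h)] at h1
    linarith
  · simp
  · have h1 := hφ.1.rightDeriv_le_slope_of_mem_interior hyint (mem_Ici.2 hz) h
    rw [slope_def_field, le_div_iff₀ (sub_pos.2 h)] at h1
    linarith

/-- Jensen's inequality for a `φ`-function and a signed density `k` of total mass at most `A`. -/
theorem IsPhiFun.jensen {φ : ℝ → ℝ} (hφ : IsPhiFun φ) {α : Type*} [MeasurableSpace α]
    {μ : Measure α} {k g : α → ℝ} {A l : ℝ} (hA : 0 < A) (hl : 0 < l) (hk : Integrable k μ)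
    (hkA : ∫ t, |k t| ∂μ ≤ A) (hg : Integrable (fun t => k t * g t) μ) :
    ENNReal.ofReal (φ |l * ∫ t, k t * g t ∂μ|) ≤
      ∫⁻ t, ENNReal.ofReal (φ |l * A * g t|) *
        (ENNReal.ofReal A⁻¹ * ENNReal.ofReal |k t|) ∂μ := by
  set y := |l * ∫ t, k t * g t ∂μ| with hy
  rcases eq_or_lt_of_le (abs_nonneg (l * ∫ t, k t * g t ∂μ)) with h0 | h0
  · rw [← h0] at hy
    simp [hy, hφ.map_zero]
  obtain ⟨p, hp⟩ := hφ.exists_supporting_line h0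
  rw [← hy] at hp h0
  have hp0 := hp 0 le_rfl
  rw [hφ.map_zero] at hp0
  have hφy : 0 < φ y := lt_of_le_of_ne (hφ.2.1 y h0.le)
    fun h => h0.ne' ((hφ.2.2.1 y h0.le).1 h.symm)
  have hp_pos : 0 ≤ p := by
    by_contra! h
    nlinarith
  set q : α → ℝ := fun t => A⁻¹ * (φ y - p * y) * |k t| + p * l * |k t * g t| with hq
  have hq_int : Integrable q μ := (hk.abs.const_mul _).add (hg.abs.const_mul _)
  have hq_ge : φ y ≤ ∫ t, q t ∂μ := by
    rw [hq, integral_add (hk.abs.const_mul _) (hg.abs.const_mul _), integral_const_mul,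
      integral_const_mul]
    have h1 : A⁻¹ * ∫ t, |k t| ∂μ ≤ 1 := by
      rw [inv_mul_le_iff₀ hA]
      simpa using hkA
    have h2 : y ≤ l * ∫ t, |k t * g t| ∂μ := by
      rw [hy, abs_mul, abs_of_pos hl]
      exact mul_le_mul_of_nonneg_left abs_integral_le_integral_abs hl.le
    nlinarith [mul_le_mul_of_nonneg_left h2 hp_pos]
  have hq_le : ∀ t, ENNReal.ofReal (q t) ≤ ENNReal.ofReal (φ |l * A * g t|) *
      (ENNReal.ofReal A⁻¹ * ENNReal.ofReal |k t|) := by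
    intro t
    rw [← ENNReal.ofReal_mul (inv_nonneg.2 hA.le), ← ENNReal.ofReal_mul (hφ.2.1 _ (abs_nonneg _))]
    refine ENNReal.ofReal_le_ofReal ?_
    have h1 := mul_le_mul_of_nonneg_right (hp _ (abs_nonneg (l * A * g t)))
      (mul_nonneg (inv_nonneg.2 hA.le) (abs_nonneg (k t)))
    refine le_trans (le_of_eq ?_) h1
    simp only [hq, abs_mul, abs_of_pos hl, abs_of_pos hA]
    field_simp
    ring
  calc ENNReal.ofReal (φ y) ≤ ENNReal.ofReal (∫ t, max (q t) 0 ∂μ) :=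
        ENNReal.ofReal_le_ofReal (hq_ge.trans
          (integral_mono hq_int hq_int.pos_part fun t => le_max_left _ _))
    _ = ∫⁻ t, ENNReal.ofReal (max (q t) 0) ∂μ :=
        ofReal_integral_eq_lintegral_ofReal hq_int.pos_part (ae_of_all _ fun t => le_max_right _ _)
    _ ≤ _ := lintegral_mono fun t => by
        simpa using hq_le t

/-! ### The one-dimensional `φ`-variation -/

theorem aemeasurable_phiVar1 {φ : ℝ → ℝ} (hφ : IsPhiFun φ) {X : Type*} [TopologicalSpace X]
    [PolishSpace X] [MeasurableSpace X] [BorelSpace X] (μ : Measure X) [SFinite μ]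
    {G : X → ℝ → ℝ} (hG : Measurable (Function.uncurry G)) (a b : ℝ) :
    AEMeasurable (fun x => phiVar1 φ a b (G x)) μ := by
  refine AEMeasurable.iSup fun n => ?_
  have hU : MeasurableSet
      {u : Fin (n + 1) → ℝ | Monotone u ∧ u 0 = a ∧ u (Fin.last n) = b} :=
    isClosed_monotone.measurableSet.inter
      ((measurableSet_eq_fun (measurable_pi_apply _) measurable_const).inter
        (measurableSet_eq_fun (measurable_pi_apply _) measurable_const))
  have hGi : ∀ i : Fin (n + 1),
      Measurable fun p : X × (Fin (n + 1) → ℝ) => G p.1 (p.2 i) := fun i =>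
    hG.comp (measurable_fst.prodMk ((measurable_pi_apply i).comp measurable_snd))
  have hF : Measurable fun p : X × (Fin (n + 1) → ℝ) =>
      ∑ i : Fin n, ENNReal.ofReal (φ |G p.1 (p.2 i.succ) - G p.1 (p.2 i.castSucc)|) :=
    Finset.measurable_fun_sum _ fun i _ => ENNReal.measurable_ofReal.comp
      (hφ.measurable_comp_abs.comp ((hGi _).sub (hGi _)))
  simpa only [mem_ofPred_eq, iSup_and] using aemeasurable_biSup_of_measurable_uncurry μ hF hU

/-- The `φ`-variation of an average of functions is bounded by the average of the
`φ`-variations. -/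
theorem phiVar1_integral_le {φ : ℝ → ℝ} (hφ : IsPhiFun φ) {α : Type*} [MeasurableSpace α]
    {μ : Measure α} {k : α → ℝ} {G : α → ℝ → ℝ} {A l a b : ℝ} (hA : 0 < A) (hl : 0 < l)
    (hk : Integrable k μ) (hkA : ∫ t, |k t| ∂μ ≤ A) (hGm : ∀ s, Measurable fun t => G t s)
    (hG : ∀ s, a ≤ s → Integrable (fun t => k t * G t s) μ) :
    phiVar1 φ a b (fun s => l * ∫ t, k t * G t s ∂μ) ≤
      ∫⁻ t, phiVar1 φ a b (fun s => l * A * G t s) *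
        (ENNReal.ofReal A⁻¹ * ENNReal.ofReal |k t|) ∂μ := by
  refine iSup_le fun n => iSup_le fun u => iSup_le fun hu => iSup_le fun hua =>
    iSup_le fun hub => ?_
  have hau : ∀ i, a ≤ u i := fun i => hua ▸ hu (Fin.zero_le i)
  have hterm : ∀ i : Fin n,
      ENNReal.ofReal (φ |l * ∫ t, k t * G t (u i.succ) ∂μ -
        l * ∫ t, k t * G t (u i.castSucc) ∂μ|) ≤
      ∫⁻ t, ENNReal.ofReal (φ |l * A * G t (u i.succ) - l * A * G t (u i.castSucc)|) *
        (ENNReal.ofReal A⁻¹ * ENNReal.ofReal |k t|) ∂μ := by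
    intro i
    have h1 := hG _ (hau i.succ)
    have h2 := hG _ (hau i.castSucc)
    have h := hφ.jensen (g := fun t => G t (u i.succ) - G t (u i.castSucc)) hA hl hk hkA
      (by simp only [mul_sub]; exact h1.sub h2)
    simpa only [mul_sub, integral_sub h1 h2] using h
  refine (Finset.sum_le_sum fun i _ => hterm i).trans ?_
  rw [← lintegral_finsetSum']
  · refine lintegral_mono fun t => ?_
    rw [← Finset.sum_mul]
    gcongr
    exact le_iSup_of_le n <| le_iSup_of_le u <| le_iSup_of_le hu <| le_iSup_of_le hua <|
      le_iSup_of_le hub le_rfl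
  · intro i _
    refine AEMeasurable.mul (Measurable.aemeasurable ?_)
      (hk.abs.aemeasurable.ennreal_ofReal.const_mul _)
    exact ENNReal.measurable_ofReal.comp (hφ.measurable_comp_abs.comp
      (((hGm _).const_mul _).sub ((hGm _).const_mul _)))

/-! ### Minkowski's integral inequality for finite Euclidean sums -/

theorem sqrt_sum_sq_lintegral_le {α ι : Type*} [MeasurableSpace α] [Fintype ι] {μ : Measure α}
    {g : ι → α → ℝ≥0∞} (hg : ∀ j, AEMeasurable (g j) μ) :
    (∑ j, (∫⁻ t, g j t ∂μ) ^ 2) ^ ((1 : ℝ) / 2) ≤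
      ∫⁻ t, (∑ j, g j t ^ 2) ^ ((1 : ℝ) / 2) ∂μ := by
  set S := (∑ j, (∫⁻ t, g j t ∂μ) ^ 2) ^ ((1 : ℝ) / 2) with hS
  have hSsq : S * S = ∑ j, (∫⁻ t, g j t ∂μ) ^ 2 := by
    rw [← sq, hS, ← ENNReal.rpow_natCast, ← ENNReal.rpow_mul]
    norm_num
  have hle : ∀ j t, g j t ≤ (∑ j, g j t ^ 2) ^ ((1 : ℝ) / 2) := by
    intro j t
    rw [one_div, ENNReal.le_rpow_inv_iff (by norm_num)]
    simpa using Finset.single_le_sum (f := fun j => g j t ^ 2) (fun _ _ => zero_le)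
      (Finset.mem_univ j)
  by_cases htop : ∃ j, ∫⁻ t, g j t ∂μ = ⊤
  · obtain ⟨j, hj⟩ := htop
    refine le_top.trans (hj.symm.le.trans (lintegral_mono (hle j)))
  push Not at htop
  rcases eq_or_ne S 0 with h0 | h0
  · simp [h0]
  have hStop : S ≠ ⊤ := by
    refine ENNReal.rpow_ne_top_of_nonneg (by norm_num) ?_
    exact ENNReal.sum_ne_top.2 fun j _ => ENNReal.pow_ne_top (htop j)
  refine (ENNReal.mul_le_mul_iff_right h0 hStop).1 ?_
  calc S * S = ∑ j, ∫⁻ t, (∫⁻ t, g j t ∂μ) * g j t ∂μ := by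
        rw [hSsq]
        refine Finset.sum_congr rfl fun j _ => ?_
        rw [lintegral_const_mul' _ _ (htop j), sq]
    _ = ∫⁻ t, ∑ j, (∫⁻ t, g j t ∂μ) * g j t ∂μ :=
        (lintegral_finsetSum' _ fun j _ => (hg j).const_mul _).symm
    _ ≤ ∫⁻ t, S * (∑ j, g j t ^ 2) ^ ((1 : ℝ) / 2) ∂μ := by
        refine lintegral_mono fun t => ?_
        simpa [hS] using ENNReal.inner_le_Lp_mul_Lq Finset.univ (fun j => ∫⁻ t, g j t ∂μ)
          (fun j => g j t) Real.HolderConjugate.two_two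
    _ = _ := lintegral_const_mul' _ _ hStop

theorem sum_lintegral_le_lintegral_sum {α ι : Type*} [MeasurableSpace α] {μ : Measure α}
    (s : Finset ι) (g : ι → α → ℝ≥0∞) :
    ∑ i ∈ s, ∫⁻ t, g i t ∂μ ≤ ∫⁻ t, ∑ i ∈ s, g i t ∂μ := by
  classical
  induction s using Finset.induction_on with
  | empty => simp
  | insert i s hi ih =>
    simp only [Finset.sum_insert hi]
    exact (add_le_add le_rfl ih).trans (le_lintegral_add _ _)

/-! ### Sections and boxes -/

theorem measurableSet_rPos (N : ℕ) : MeasurableSet (RPos N) := by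
  have : RPos N = univ.pi fun _ => Ioi 0 := by
    ext x
    simp [RPos]
  rw [this]
  exact MeasurableSet.univ_pi fun _ => measurableSet_Ioi

theorem prodCoord_pos {N : ℕ} {t : Fin N → ℝ} (ht : t ∈ RPos N) : 0 < prodCoord t :=
  Finset.prod_pos fun i _ => ht i

theorem measurable_insertCoord {N : ℕ} (j : Fin N) :
    Measurable fun p : ({i : Fin N // i ≠ j} → ℝ) × ℝ => insertCoord j p.1 p.2 := by
  refine measurable_pi_lambda _ fun i => ?_
  by_cases h : i = j
  · simpa [insertCoord, h] using measurable_snd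
  · simp only [insertCoord, h, dite_false]
    exact (measurable_pi_apply _).comp measurable_fst

theorem insertCoord_mem_rPos {N : ℕ} {j : Fin N} {x' : {i : Fin N // i ≠ j} → ℝ} {s : ℝ}
    (hx : ∀ i, 0 < x' i) (hs : 0 < s) : insertCoord j x' s ∈ RPos N := by
  intro i
  by_cases h : i = j
  · simpa [insertCoord, h] using hs
  · simpa [insertCoord, h] using hx ⟨i, h⟩

theorem IsBoxPartition.le_left {N m : ℕ} {a b : Fin N → ℝ} {c d : Fin m → Fin N → ℝ}
    (h : IsBoxPartition a b c d) (k : Fin m) (i : Fin N) : a i ≤ c k i := by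
  have hmem : c k ∈ univ.pi fun i => Icc (a i) (b i) := by
    rw [← h.2.1]
    exact mem_iUnion.2 ⟨k, fun i _ => ⟨le_rfl, h.1 k i⟩⟩
  exact (hmem i (mem_univ i)).1

/-- The integrand of `secVar` for the family of dilates `s ↦ L f(st)` is jointly almost everywhere
measurable in the section and the dilation parameter. -/
theorem aemeasurable_section_dilate {N : ℕ} {φ : ℝ → ℝ} (hφ : IsPhiFun φ)
    {f : (Fin N → ℝ) → ℝ} (hf : Measurable f) (j : Fin N) (L a b : ℝ)
    (ρ : Measure (({i : Fin N // i ≠ j} → ℝ) × (Fin N → ℝ))) [SFinite ρ] :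
    AEMeasurable (fun p : ({i : Fin N // i ≠ j} → ℝ) × (Fin N → ℝ) =>
      phiVar1 φ a b (fun s => L * f (insertCoord j p.1 s * p.2)) *
        ENNReal.ofReal ((∏ i, p.1 i)⁻¹)) ρ := by
  refine AEMeasurable.mul (aemeasurable_phiVar1 hφ ρ (G := fun p s =>
    L * f (insertCoord j p.1 s * p.2)) ?_ a b) (Measurable.aemeasurable ?_)
  · refine (hf.comp ?_).const_mul L
    exact ((measurable_insertCoord j).comp
      ((measurable_fst.comp measurable_fst).prodMk measurable_snd)).mul
        (measurable_snd.comp measurable_fst)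
  · exact ENNReal.measurable_ofReal.comp (Finset.measurable_fun_prod _ fun i _ =>
      (measurable_pi_apply i).comp measurable_fst).inv

theorem boxPhi_mellinOp_le {N : ℕ} {φ : ℝ → ℝ} (hφ : IsPhiFun φ) {K f : (Fin N → ℝ) → ℝ}
    {A l : ℝ} (hA : 0 < A) (hl : 0 < l) (hf : Measurable f)
    (hK : IntegrableOn (fun t => K t * (prodCoord t)⁻¹) (RPos N))
    (hKA : ∫ t in RPos N, |K t| * (prodCoord t)⁻¹ ≤ A)
    (hdom : ∀ s ∈ RPos N, IntegrableOn (fun t => K t * f (s * t) * (prodCoord t)⁻¹) (RPos N))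
    {c d : Fin N → ℝ} (hc : ∀ i, 0 < c i) :
    boxPhi φ (fun s => l * mellinOp K f s) c d ≤
      ∫⁻ t in RPos N, boxPhi φ (fun s => l * A * f (s * t)) c d *
        (ENNReal.ofReal A⁻¹ * ENNReal.ofReal (|K t| * (prodCoord t)⁻¹)) := by
  set k : (Fin N → ℝ) → ℝ := fun t => K t * (prodCoord t)⁻¹ with hk
  have hkabs : ∀ t ∈ RPos N, |K t| * (prodCoord t)⁻¹ = |k t| := fun t ht => by
    rw [hk, abs_mul, abs_of_pos (inv_pos.2 (prodCoord_pos ht))]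
  rw [setLIntegral_congr_fun (measurableSet_rPos N)
    (g := fun t => boxPhi φ (fun s => l * A * f (s * t)) c d *
      (ENNReal.ofReal A⁻¹ * ENNReal.ofReal |k t|)) fun t ht => by
        simp only [hkabs t ht]]
  rw [setIntegral_congr_fun (measurableSet_rPos N) hkabs] at hKA
  have hmellin : ∀ s, mellinOp K f s = ∫ t in RPos N, k t * f (s * t) := fun s => by
    simp only [mellinOp, hk, mul_right_comm]
  set κ : (Fin N → ℝ) → ℝ≥0∞ := fun t => ENNReal.ofReal A⁻¹ * ENNReal.ofReal |k t| with hκ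
  have hκm : AEMeasurable κ (volume.restrict (RPos N)) :=
    hK.abs.aemeasurable.ennreal_ofReal.const_mul _
  have hκtop : ∀ t, κ t ≠ ⊤ := fun t => ENNReal.mul_ne_top ENNReal.ofReal_ne_top
    ENNReal.ofReal_ne_top
  have hjoint : ∀ j : Fin N, AEMeasurable (Function.uncurry
      fun (x' : {i : Fin N // i ≠ j} → ℝ) (t : Fin N → ℝ) =>
      phiVar1 φ (c j) (d j) (fun s => l * A * f (insertCoord j x' s * t)) *
        ENNReal.ofReal ((∏ i, x' i)⁻¹) * κ t)
      ((volume.restrict (univ.pi fun i : {i : Fin N // i ≠ j} => Icc (c i.1) (d i.1))).prod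
        (volume.restrict (RPos N))) := fun j =>
    (aemeasurable_section_dilate hφ hf j _ _ _ _).mul hκm.comp_snd
  have hsec : ∀ j, secVar φ (fun s => l * mellinOp K f s) c d j ≤
      ∫⁻ t in RPos N, secVar φ (fun s => l * A * f (s * t)) c d j * κ t := by
    intro j
    calc secVar φ (fun s => l * mellinOp K f s) c d j
        ≤ ∫⁻ x' in univ.pi fun i : {i : Fin N // i ≠ j} => Icc (c i.1) (d i.1),
            ∫⁻ t in RPos N,
              phiVar1 φ (c j) (d j) (fun s => l * A * f (insertCoord j x' s * t)) *
                ENNReal.ofReal ((∏ i, x' i)⁻¹) * κ t := by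
          refine setLIntegral_mono' (MeasurableSet.univ_pi fun _ => measurableSet_Icc)
            fun x' hx' => ?_
          have hpos : ∀ i, 0 < x' i := fun i => (hc i.1).trans_le (hx' i (mem_univ i)).1
          have h := phiVar1_integral_le hφ (b := d j) (G := fun t s => f (insertCoord j x' s * t))
            hA hl hK hKA
            (fun s => hf.comp (measurable_const.mul measurable_id)) fun s hs => by
              have := hdom _ (insertCoord_mem_rPos hpos ((hc j).trans_le hs))
              simpa only [hk, mul_right_comm, IntegrableOn] using this
          simp only [hmellin]
          refine (mul_le_mul_left h _).trans (le_of_eq ?_)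
          rw [← lintegral_mul_const' _ _ ENNReal.ofReal_ne_top]
          simp only [hκ, mul_right_comm]
      _ = ∫⁻ t in RPos N, ∫⁻ x' in univ.pi fun i : {i : Fin N // i ≠ j} => Icc (c i.1) (d i.1),
              phiVar1 φ (c j) (d j) (fun s => l * A * f (insertCoord j x' s * t)) *
                ENNReal.ofReal ((∏ i, x' i)⁻¹) * κ t :=
          lintegral_lintegral_swap (hjoint j)
      _ = _ := lintegral_congr fun t => lintegral_mul_const' _ _ (hκtop t)
  have hsecm : ∀ j, AEMeasurable (fun t => secVar φ (fun s => l * A * f (s * t)) c d j * κ t)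
      (volume.restrict (RPos N)) := fun j =>
    AEMeasurable.congr (hjoint j).lintegral_prod_left'
      (ae_of_all _ fun t => lintegral_mul_const' _ _ (hκtop t))
  calc boxPhi φ (fun s => l * mellinOp K f s) c d
      ≤ (∑ j, (∫⁻ t in RPos N, secVar φ (fun s => l * A * f (s * t)) c d j * κ t) ^ 2) ^
          ((1 : ℝ) / 2) := by
        unfold boxPhi
        gcongr with j _
        exact hsec j
    _ ≤ _ := sqrt_sum_sq_lintegral_le hsecm
    _ = _ := lintegral_congr fun t => by
        have h2 : (κ t ^ 2) ^ ((1 : ℝ) / 2) = κ t := by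
          rw [← ENNReal.rpow_natCast, ← ENNReal.rpow_mul]
          norm_num
        simp only [mul_pow, ← Finset.sum_mul]
        rw [ENNReal.mul_rpow_of_nonneg _ _ (by norm_num), h2, boxPhi]

/-- for every interval `I ⊂ ℝ^N_+`, `λ > 0` and `w > 0`,
`V^φ_I[λ(T_w f)] ≤ A⁻¹ ∫_{ℝ^N_+} V^φ_I[λ A (τ_t f)] |K_w(t)| ⟨t⟩⁻¹ dt`. -/
theorem statement1 {N : ℕ} (hN : 1 ≤ N) (φ : ℝ → ℝ) (hφ : IsPhiFun φ)
    (K : ℝ → (Fin N → ℝ) → ℝ) (A : ℝ) (hA : 0 < A) (hK : KernelCond1 K A)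
    (f : (Fin N → ℝ) → ℝ) (hf : Measurable f) (hdom : InDomain K f) :
    ∀ a b : Fin N → ℝ, (∀ i, 0 < a i) → (∀ i, a i ≤ b i) →
      ∀ l > (0 : ℝ), ∀ w > (0 : ℝ),
        varOn φ (fun s => l * mellinOp (K w) f s) a b ≤
          ENNReal.ofReal A⁻¹ *
            ∫⁻ t in RPos N,
              varOn φ (fun s => l * A * f (s * t)) a b *
                ENNReal.ofReal (|K w t| * (prodCoord t)⁻¹) := by
  intro a b ha hab l hl w hw
  obtain ⟨-, hKint, hKA, -⟩ := hK w hw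
  rw [← lintegral_const_mul' _ _ ENNReal.ofReal_ne_top]
  refine iSup_le fun m => iSup_le fun c => iSup_le fun d => iSup_le fun hcd => ?_
  refine (Finset.sum_le_sum fun k _ => boxPhi_mellinOp_le hφ hA hl hf hKint hKA (hdom w hw)
    fun i => (ha i).trans_le (hcd.le_left k i)).trans ?_
  refine (sum_lintegral_le_lintegral_sum _ _).trans (lintegral_mono fun t => ?_)
  rw [← Finset.sum_mul, mul_left_comm]
  gcongr
  exact le_iSup_of_le m <| le_iSup_of_le c <| le_iSup_of_le d <| le_iSup_of_le hcd le_rfl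

end
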